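/- arXiv:2403.17730 — 2 statements merged into one kernel-verified Lean document; each statement's English description precedes it below -/
import Mathlib

section
/- For all noncommutative formal power series c, d, e ∈ ℝ⟨⟨X⟩⟩ over the alphabet X = {x₀, x₁}, the composition product distributes over the shuffle product on the left: (c ⧢ d) ∘ e = (c ∘ e) ⧢ (d ∘ e). -/
open scoped Classical

/-!  Common setup: noncommutative formal power series ℝ⟨⟨X⟩⟩ over the
alphabet X = {x₀, x₁}.  Words are encoded as lists over `Fin 2`
(the letter `0` is x₀ and `1` is x₁); a series is a function from words
to ℝ, recording its coefficients. -/

/-- Words over the alphabet X = {x₀, x₁}. -/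
abbrev Word : Type := List (Fin 2)

/-- Noncommutative formal power series ℝ⟨⟨X⟩⟩. -/
abbrev Ser : Type := Word → ℝ

/-- The series 𝟙 (the empty word). -/
def one1 : Ser := fun w => if w = [] then 1 else 0

/-- A single word η regarded as a series. -/
def mono (η : Word) : Ser := fun w => if w = η then 1 else 0

/-- Left concatenation of a series by the letter `x_i`. -/
def lc (i : Fin 2) (c : Ser) : Ser := fun w =>
  match w with
  | [] => 0
  | j :: u => if j = i then c u else 0

/-- Auxiliary recursion computing the coefficient of a word `w` in `c ⧢ d`:
`(c ⧢ d)(𝟙) = c(𝟙) d(𝟙)` and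
`(c ⧢ d)(x_i w) = ((x_i⁻¹ c) ⧢ d)(w) + (c ⧢ (x_i⁻¹ d))(w)`,
where `x_i⁻¹` is the left shift.  This dual recursion is exactly the
bilinear extension of the inductive shuffle of words
`(x_i ξ) ⧢ (x_j η) = x_i (ξ ⧢ x_j η) + x_j (x_i ξ ⧢ η)`, `𝟙 ⧢ η = η ⧢ 𝟙 = η`. -/
def shAux : Word → Ser → Ser → ℝ
  | [], c, d => c [] * d []
  | i :: w, c, d => shAux w (fun u => c (i :: u)) d + shAux w c (fun u => d (i :: u))

/-- The shuffle product `⧢` on ℝ⟨⟨X⟩⟩. -/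
def sh (c d : Ser) : Ser := fun w => shAux w c d

/-- Shuffle powers `c^{⧢ k}`. -/
def shPow (c : Ser) : ℕ → Ser
  | 0 => one1
  | k + 1 => sh c (shPow c k)

/-- The shuffle inverse `c^{⧢ -1} = Σ_{k ≥ 0} (𝟙 - c)^{⧢ k}`.
When `c(𝟙) = 1` the sum is locally finite (for each word only finitely many
terms are nonzero) and `∑'` returns it. -/
noncomputable def shInv (c : Ser) : Ser := fun w => ∑' k : ℕ, shPow (one1 - c) k w

/-- Composition product restricted to words: `𝟙 ∘ d = 𝟙`,
`(x₀ η) ∘ d = x₀ (η ∘ d)`, `(x₁ η) ∘ d = x₀ (d ⧢ (η ∘ d))`. -/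
def wordComp : Word → Ser → Ser
  | [], _ => one1
  | i :: η, d => if i = 0 then lc 0 (wordComp η d) else lc 0 (sh d (wordComp η d))

/-- The composition product `c ∘ d = Σ_η c(η) (η ∘ d)`.  For each fixed word
only finitely many terms are nonzero, and `∑'` returns the sum. -/
noncomputable def comp (c d : Ser) : Ser := fun w => ∑' η : Word, c η * wordComp η d w

/-- Membership in the set `G`: pairs `(d₁, d₂)` with `d₁(𝟙) = 1`. -/
def inG (d : Ser × Ser) : Prop := d.1 [] = 1

/-- Mixed composition product restricted to words: `𝟙 ◁ d = 𝟙`,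
`(x₀ η) ◁ d = x₀ (η ◁ d)`,
`(x₁ η) ◁ d = x₁ (d₁ ⧢ (η ◁ d)) + x₀ (d₂ ⧢ (η ◁ d))`. -/
def wordMComp : Word → Ser × Ser → Ser
  | [], _ => one1
  | i :: η, d =>
      if i = 0 then lc 0 (wordMComp η d)
      else lc 1 (sh d.1 (wordMComp η d)) + lc 0 (sh d.2 (wordMComp η d))

/-- The mixed composition product `c ◁ d = Σ_η c(η) (η ◁ d)`. -/
noncomputable def mcomp (c : Ser) (d : Ser × Ser) : Ser :=
  fun w => ∑' η : Word, c η * wordMComp η d w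

/-- Componentwise mixed composition `c ⊲ d = (c₁ ◁ d, c₂ ◁ d)`. -/
noncomputable def tri (c d : Ser × Ser) : Ser × Ser := (mcomp c.1 d, mcomp c.2 d)

/-- Componentwise composition `d ∘̄ c = (d₁ ∘ c, d₂ ∘ c)`. -/
noncomputable def bcomp (d : Ser × Ser) (c : Ser) : Ser × Ser := (comp d.1 c, comp d.2 c)

/-- The group product `⊙` on `G`:
`(c₁, c₂) ⊙ (d₁, d₂) = (c₁ ⧢ d₁, c₂ + d₂ ⧢ c₁)`. -/
def odot (c d : Ser × Ser) : Ser × Ser := (sh c.1 d.1, c.2 + sh d.2 c.1)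

/-- The identity element `e = (𝟙, 0)`. -/
def eG : Ser × Ser := (one1, 0)

/-- The `⊙`-inverse `c^{⊙ -1} = (c₁^{⧢ -1}, -(c₁^{⧢ -1} ⧢ c₂))`. -/
noncomputable def odotInv (c : Ser × Ser) : Ser × Ser :=
  (shInv c.1, -(sh (shInv c.1) c.2))

/-- The affine feedback group product `c ⋆ d = (c ⊲ d) ⊙ d` on `G`. -/
noncomputable def star (c d : Ser × Ser) : Ser × Ser := odot (tri c d) d

/-- The `⋆`-inverse of an element of `G` (defined via choice; for an element
of the group `(G, ⋆)` it is the unique two-sided `⋆`-inverse). -/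
noncomputable def starInv (x : Ser × Ser) : Ser × Ser :=
  if h : ∃ y : Ser × Ser, inG y ∧ star x y = eG ∧ star y x = eG then h.choose else x

/-- The affine feedback product `c @ d = c ◁ ((d^{⊙ -1}) ∘̄ c)^{⋆ -1}`. -/
noncomputable def atp (c : Ser) (d : Ser × Ser) : Ser :=
  mcomp c (starInv (bcomp (odotInv d) c))

/-- Membership in ℝ[[x₀]]: series vanishing on every word containing x₁. -/
def inRx0 (c : Ser) : Prop := ∀ w : Word, (1 : Fin 2) ∈ w → c w = 0

/-- Left shift of a series by the letter `x_i`. -/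
def leftShift (i : Fin 2) (c : Ser) : Ser := fun u => c (i :: u)

theorem sh_nil (c d : Ser) : sh c d [] = c [] * d [] := rfl

theorem sh_cons (c d : Ser) (i : Fin 2) (w : Word) :
    sh c d (i :: w) = sh (leftShift i c) d w + sh c (leftShift i d) w := rfl

theorem leftShift_sh (i : Fin 2) (c d : Ser) :
    leftShift i (sh c d) = sh (leftShift i c) d + sh c (leftShift i d) := rfl

theorem leftShift_add (i : Fin 2) (c d : Ser) :
    leftShift i (c + d) = leftShift i c + leftShift i d := rfl

theorem sh_comm (c d : Ser) : sh c d = sh d c := by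
  funext w
  induction w generalizing c d with
  | nil => simp only [sh_nil, mul_comm]
  | cons i w ih => rw [sh_cons, sh_cons, ih, ih c, add_comm]

theorem sh_add (c d e : Ser) : sh c (d + e) = sh c d + sh c e := by
  funext w
  induction w generalizing c d e with
  | nil => simp only [sh_nil, Pi.add_apply, mul_add]
  | cons i w ih =>
    simp only [sh_cons, leftShift_add, ih, Pi.add_apply]
    ring

theorem add_sh (c d e : Ser) : sh (c + d) e = sh c e + sh d e := by
  rw [sh_comm, sh_add, sh_comm e, sh_comm e]

theorem sh_assoc (c d e : Ser) : sh (sh c d) e = sh c (sh d e) := by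
  funext w
  induction w generalizing c d e with
  | nil => simp only [sh_nil, mul_assoc]
  | cons i w ih =>
    simp only [sh_cons, leftShift_sh, add_sh, sh_add, ih, Pi.add_apply]
    ring

/-- A coefficient of a shuffle product only depends on coefficients of words that are
not longer. -/
theorem sh_congr_right (c : Ser) {d d' : Ser} {w : Word}
    (h : ∀ u : Word, u.length ≤ w.length → d u = d' u) : sh c d w = sh c d' w := by
  induction w generalizing c d d' with
  | nil => rw [sh_nil, sh_nil, h [] le_rfl]
  | cons i w ih =>
    rw [sh_cons, sh_cons, ih (leftShift i c) fun u hu => h u (hu.trans (Nat.le_succ _)),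
      ih c (d := leftShift i d) (d' := leftShift i d') fun u hu =>
        h (i :: u) (Nat.succ_le_succ hu)]

theorem sh_zero (c : Ser) : sh c 0 = 0 := by
  simpa using sh_add c 0 0

theorem zero_sh (c : Ser) : sh 0 c = 0 := by
  rw [sh_comm, sh_zero]

/-- The shuffle product commutes with coefficientwise convergent sums. -/
theorem HasSum.sh_right {ι : Type*} (c : Ser) {f : ι → Ser} {g : Ser}
    (h : ∀ u, HasSum (fun k => f k u) (g u)) (w : Word) :
    HasSum (fun k => sh c (f k) w) (sh c g w) := by
  induction w generalizing c f g with
  | nil => exact (h []).mul_left (c [])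
  | cons i w ih => exact (ih (leftShift i c) h).add (ih c fun u => h (i :: u))

theorem sh_smul (a : ℝ) (c d : Ser) : sh c (a • d) = a • sh c d := by
  funext w
  induction w generalizing c d with
  | nil => simp only [sh_nil, Pi.smul_apply, smul_eq_mul]; ring
  | cons i w ih =>
    have h : leftShift i (a • d) = a • leftShift i d := rfl
    simp only [sh_cons, h, ih, Pi.smul_apply, smul_add]

theorem wordComp_eq_zero_of_length_lt (e : Ser) {η w : Word} (h : w.length < η.length) :
    wordComp η e w = 0 := by
  induction η generalizing w with
  | nil => simp at h
  | cons i η ih =>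
    cases w with
    | nil => by_cases hi : i = 0 <;> simp [wordComp, lc, hi]
    | cons j w =>
      have hw : w.length < η.length := by simpa using h
      have hsh : sh e (wordComp η e) w = 0 := by
        rw [sh_congr_right e (d' := 0) fun u hu => ih (hu.trans_lt hw), sh_zero]
        rfl
      by_cases hi : i = 0 <;> simp [wordComp, lc, hi, ih hw, hsh]

theorem hasSum_comp (c e : Ser) (w : Word) :
    HasSum (fun η => c η * wordComp η e w) (comp c e w) := by
  refine (summable_of_hasFiniteSupport
    ((List.finite_length_le (Fin 2) w.length).subset fun η hη => ?_)).hasSum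
  by_contra hlt
  exact hη (by simp [wordComp_eq_zero_of_length_lt e (not_le.mp hlt)])

theorem hasSum_lc (i : Fin 2) {f : Ser} {a : ℝ} (h : HasSum f a) : HasSum (lc i f) a := by
  have hinj : Function.Injective (List.cons i) := List.cons_injective
  refine (hinj.hasSum_iff (f := lc i f) fun η hη => ?_).mp ?_
  · cases η with
    | nil => rfl
    | cons j u =>
      have hj : j ≠ i := by
        rintro rfl
        exact hη ⟨u, rfl⟩
      simp [lc, hj]
  · simpa [Function.comp_def, lc] using h

/-- Summation over words, split according to the first letter. -/
theorem hasSum_word {f : Ser} {a b : ℝ} (h₀ : HasSum (leftShift 0 f) a)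
    (h₁ : HasSum (leftShift 1 f) b) : HasSum f (f [] + (a + b)) := by
  convert (hasSum_ite_eq ([] : Word) (f [])).add ((hasSum_lc 0 h₀).add (hasSum_lc 1 h₁)) using 1
  funext η
  cases η with
  | nil => simp [lc]
  | cons j u => fin_cases j <;> simp [lc, leftShift]

theorem comp_nil (c e : Ser) : comp c e [] = c [] := by
  refine (hasSum_comp c e []).unique ?_
  convert hasSum_ite_eq ([] : Word) (c []) using 1
  funext η
  cases η with
  | nil => simp [wordComp, one1]
  | cons i η => simp [wordComp_eq_zero_of_length_lt]

theorem leftShift_zero_comp (c e : Ser) :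
    leftShift 0 (comp c e) = comp (leftShift 0 c) e + sh e (comp (leftShift 1 c) e) := by
  funext w
  refine (hasSum_comp c e (0 :: w)).unique ?_
  have h₁ : HasSum (fun η => leftShift 1 c η * sh e (wordComp η e) w)
      (sh e (comp (leftShift 1 c) e) w) := by
    convert HasSum.sh_right e (f := fun η => leftShift 1 c η • wordComp η e)
      (hasSum_comp (leftShift 1 c) e) w using 2
    rw [sh_smul, Pi.smul_apply, smul_eq_mul]
  convert hasSum_word (f := fun η => c η * wordComp η e (0 :: w))
    (a := comp (leftShift 0 c) e w) (b := sh e (comp (leftShift 1 c) e) w) ?_ ?_ using 1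
  · simp [wordComp, one1]
  · convert hasSum_comp (leftShift 0 c) e w using 2 with η
    simp [leftShift, wordComp, lc]
  · convert h₁ using 2 with η
    simp [leftShift, wordComp, lc]

theorem leftShift_one_comp (c e : Ser) : leftShift 1 (comp c e) = 0 := by
  funext w
  refine (hasSum_comp c e (1 :: w)).unique ?_
  change HasSum _ (0 : ℝ)
  convert hasSum_zero (α := ℝ) using 1
  funext η
  cases η with
  | nil => simp [wordComp, one1]
  | cons i η => by_cases hi : i = 0 <;> simp [wordComp, lc, hi]

theorem add_comp (c d e : Ser) : comp (c + d) e = comp c e + comp d e := by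
  funext w
  refine (hasSum_comp (c + d) e w).unique ?_
  change HasSum _ (comp c e w + comp d e w)
  convert (hasSum_comp c e w).add (hasSum_comp d e w) using 1
  funext η
  rw [Pi.add_apply, add_mul]

theorem comp_sh_apply (c d e : Ser) (n : ℕ) (w : Word) (hw : w.length ≤ n) :
    comp (sh c d) e w = sh (comp c e) (comp d e) w := by
  induction n generalizing c d w with
  | zero =>
    obtain rfl := List.length_eq_zero_iff.mp (Nat.le_zero.mp hw)
    simp only [sh_nil, comp_nil]
  | succ n ih =>
    cases w with
    | nil => simp only [sh_nil, comp_nil]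
    | cons i w =>
      have hn : w.length ≤ n := by simpa using hw
      have hsh (a b : Ser) :
          sh e (comp (sh a b) e) w = sh e (sh (comp a e) (comp b e)) w :=
        sh_congr_right e fun u hu => ih a b u (hu.trans hn)
      change leftShift i (comp (sh c d) e) w = _
      rw [sh_cons]
      obtain rfl | rfl : i = 0 ∨ i = 1 := by omega
      · simp only [leftShift_zero_comp, leftShift_sh, add_comp, sh_add, add_sh, Pi.add_apply,
          hsh, ih _ _ w hn, sh_assoc]
        rw [← sh_assoc (comp c e) e, sh_comm (comp c e) e, sh_assoc]
        ring
      · simp only [leftShift_one_comp, sh_zero, zero_sh, Pi.zero_apply, add_zero]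


/-- the composition product distributes over the shuffle
product on the left: `(c ⧢ d) ∘ e = (c ∘ e) ⧢ (d ∘ e)`. -/
theorem comp_distrib_shuffle_left (c d e : Ser) :
    comp (sh c d) e = sh (comp c e) (comp d e) := by
  funext w
  exact comp_sh_apply c d e w.length w le_rfl
end

section
/- The mixed composition product is well defined on the quotient ℝ⟨⟨X⟩⟩/ℝ[[x₀]]: if c, h ∈ ℝ⟨⟨X⟩⟩ satisfy c − h ∈ ℝ[[x₀]], then for every d ∈ G one has (c ◁ d) − (h ◁ d) ∈ ℝ[[x₀]]. -/
open scoped Classical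

/-- If `η` is a power of `x₀`, then `η ◁ d` is a series in `x₀` alone. -/
theorem inRx0_wordMComp {η : Word} (hη : (1 : Fin 2) ∉ η) (d : Ser × Ser) :
    inRx0 (wordMComp η d) := by
  induction η with
  | nil =>
    intro w hw
    exact if_neg (List.ne_nil_of_mem hw)
  | cons i η ih =>
    obtain ⟨hi, hη'⟩ := not_or.mp (mt List.mem_cons.mpr hη)
    obtain rfl : i = 0 := by lia
    rintro (_ | ⟨j, u⟩) hw
    · simp at hw
    · by_cases hj : j = 0
      · subst hj
        simpa [wordMComp, lc] using ih hη' u (by simpa using hw)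
      · simp [wordMComp, lc, hj]

/-- the mixed composition product is well defined on the
quotient `ℝ⟨⟨X⟩⟩/ℝ[[x₀]]`: if `c - h ∈ ℝ[[x₀]]` then for every `d ∈ G`,
`(c ◁ d) - (h ◁ d) ∈ ℝ[[x₀]]`. -/
theorem mcomp_well_defined_on_quotient (c h : Ser) (hch : inRx0 (c - h))
    (d : Ser × Ser) (hd : inG d) : inRx0 (mcomp c d - mcomp h d) := by
  intro w hw
  refine sub_eq_zero.mpr (tsum_congr fun η => ?_)
  by_cases hη : (1 : Fin 2) ∈ η
  · rw [sub_eq_zero.mp (hch η hη)]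
  · simp [inRx0_wordMComp hη d w hw]
end
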